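/- (CBV one-step simulation.) Let t, u be CBV terms and R ∈ {dB, sV}. If t →ᵛF u by firing rule R (under some CBV full context), then in λ! the term tᵛ reaches uᵛ by one →F-step of rule Rᵛ followed by zero or more →F,d!-steps: tᵛ (→F by Rᵛ) ∘ (→F,d!)* uᵛ. -/

import Mathlib

namespace BangPaper

/-! ### Generic rewriting notions -/

/-- `a` is a normal form for the relation `r`. -/
def IsNF {α : Type*} (r : α → α → Prop) (a : α) : Prop := ∀ b, ¬ r a b

/-- Reflexive-transitive closure of the union of two relations,
counting the number of steps of each. -/
inductive Counted2 {α : Type*} (r₁ r₂ : α → α → Prop) : ℕ → ℕ → α → α → Prop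
  | refl (t : α) : Counted2 r₁ r₂ 0 0 t t
  | step₁ {t u v : α} {m n : ℕ} :
      r₁ t u → Counted2 r₁ r₂ m n u v → Counted2 r₁ r₂ (m + 1) n t v
  | step₂ {t u v : α} {m n : ℕ} :
      r₂ t u → Counted2 r₁ r₂ m n u v → Counted2 r₁ r₂ m (n + 1) t v

/-- Reflexive-transitive closure of the union of three relations,
counting the number of steps of each. -/
inductive Counted3 {α : Type*} (r₁ r₂ r₃ : α → α → Prop) : ℕ → ℕ → ℕ → α → α → Prop
  | refl (t : α) : Counted3 r₁ r₂ r₃ 0 0 0 t t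
  | step₁ {t u v : α} {m n k : ℕ} :
      r₁ t u → Counted3 r₁ r₂ r₃ m n k u v → Counted3 r₁ r₂ r₃ (m + 1) n k t v
  | step₂ {t u v : α} {m n k : ℕ} :
      r₂ t u → Counted3 r₁ r₂ r₃ m n k u v → Counted3 r₁ r₂ r₃ m (n + 1) k t v
  | step₃ {t u v : α} {m n k : ℕ} :
      r₃ t u → Counted3 r₁ r₂ r₃ m n k u v → Counted3 r₁ r₂ r₃ m n (k + 1) t v

/-! ### Terms of the distant Bang calculus λ! (de Bruijn representation) -/

/-- Terms of λ!: variables, application, abstraction, bang, dereliction and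
explicit substitution (`sub t u` is `t[x←u]`, the binder being in `t`). -/
inductive T : Type
  | var : ℕ → T
  | app : T → T → T
  | lam : T → T
  | bang : T → T
  | der : T → T
  | sub : T → T → T

namespace T

/-- Lift (shift by one) the free de Bruijn variables `≥ k`. -/
def lift (k : ℕ) : T → T
  | var n => if n < k then var n else var (n + 1)
  | app a b => app (lift k a) (lift k b)
  | lam a => lam (lift (k + 1) a)
  | bang a => bang (lift k a)
  | der a => der (lift k a)
  | sub a b => sub (lift (k + 1) a) (lift k b)

/-- Lift all free variables by `m` (crossing `m` binders). -/
def liftN (m : ℕ) (t : T) : T := (lift 0)^[m] t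

/-- Lift all free variables except the first one by `m`
(used to push a term with one distinguished bound variable under `m` extra binders). -/
def liftUnder (m : ℕ) (t : T) : T := (lift 1)^[m] t

/-- Capture-avoiding substitution `t{k := u}` of `u` for de Bruijn variable `k`. -/
def subst : T → ℕ → T → T
  | var n, k, u => if n < k then var n else if n = k then liftN k u else var (n - 1)
  | app a b, k, u => app (subst a k u) (subst b k u)
  | lam a, k, u => lam (subst a (k + 1) u)
  | bang a, k, u => bang (subst a k u)
  | der a, k, u => der (subst a k u)
  | sub a b, k, u => sub (subst a (k + 1) u) (subst b k u)

/-- The number of constructors (full size) of a term: it counts all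
applications, abstractions, explicit substitutions, `!` and `der` occurrences. -/
def size : T → ℕ
  | var _ => 0
  | app a b => 1 + size a + size b
  | lam a => 1 + size a
  | bang a => 1 + size a
  | der a => 1 + size a
  | sub a b => 1 + size a + size b

end T

/-- Plugging a term into a list context `⟨·⟩[x₁←t₁]…[xₙ←tₙ]`
(represented as the list `[t₁, …, tₙ]`). -/
def fillL : T → List T → T
  | s, [] => s
  | s, t :: L => fillL (T.sub s t) L

/-! ### Rewrite rules of λ! -/

/-- The names of the three rewrite rules of λ!: `dB`, `s!` and `d!`. -/
inductive Rule : Type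
  | dB : Rule
  | sBang : Rule
  | dBang : Rule

/-- Root steps of the three rewrite rules of λ! (at a distance, capture-free):
`(dB)  L⟨λx.t⟩ u ↦ L⟨t[x←u]⟩`, `(s!)  t[x←L⟨!u⟩] ↦ L⟨t{x:=u}⟩`,
`(d!)  der(L⟨!t⟩) ↦ L⟨t⟩`. -/
inductive Root : Rule → T → T → Prop
  | dB (t u : T) (L : List T) :
      Root Rule.dB (T.app (fillL (T.lam t) L) u)
        (fillL (T.sub t (T.liftN L.length u)) L)
  | sBang (t u : T) (L : List T) :
      Root Rule.sBang (T.sub t (fillL (T.bang u) L))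
        (fillL (T.subst (T.liftUnder L.length t) 0 u) L)
  | dBang (t : T) (L : List T) :
      Root Rule.dBang (T.der (fillL (T.bang t) L)) (fillL t L)

/-! ### Contexts of λ! -/

/-- (Full) contexts of λ!: terms with exactly one hole, the hole may occur anywhere. -/
inductive Ctx : Type
  | hole : Ctx
  | appL : Ctx → T → Ctx
  | appR : T → Ctx → Ctx
  | lam : Ctx → Ctx
  | bang : Ctx → Ctx
  | der : Ctx → Ctx
  | subL : Ctx → T → Ctx
  | subR : T → Ctx → Ctx

namespace Ctx

/-- Plugging a term in a context (possibly capturing its free variables). -/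
def fill : Ctx → T → T
  | hole, s => s
  | appL C t, s => T.app (fill C s) t
  | appR t C, s => T.app t (fill C s)
  | lam C, s => T.lam (fill C s)
  | bang C, s => T.bang (fill C s)
  | der C, s => T.der (fill C s)
  | subL C t, s => T.sub (fill C s) t
  | subR t C, s => T.sub t (fill C s)

/-- Surface contexts: the hole does not occur under a `!`. -/
def Surface : Ctx → Prop
  | hole => True
  | appL C _ => Surface C
  | appR _ C => Surface C
  | lam C => Surface C
  | bang _ => False
  | der C => Surface C
  | subL C _ => Surface C
  | subR _ C => Surface C

/-- Internal contexts: the full contexts that are not surface (the hole occurs under a `!`). -/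
def Internal (C : Ctx) : Prop := ¬ Surface C

end Ctx

/-! ### Reductions of λ! -/

/-- `StepAt R C t u`: `t` rewrites to `u` by firing a redex of rule `R` under context `C`. -/
def StepAt (R : Rule) (C : Ctx) (t u : T) : Prop :=
  ∃ a b, Root R a b ∧ t = C.fill a ∧ u = C.fill b

/-- One step of rule `R` under some full context (`→F,R`). -/
def FStepR (R : Rule) (t u : T) : Prop := ∃ C : Ctx, StepAt R C t u

/-- One step of rule `R` under some surface context (`→S,R`). -/
def SStepR (R : Rule) (t u : T) : Prop := ∃ C : Ctx, C.Surface ∧ StepAt R C t u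

/-- One step of rule `R` under some internal context (`→I,R`). -/
def IStepR (R : Rule) (t u : T) : Prop := ∃ C : Ctx, C.Internal ∧ StepAt R C t u

/-- Full reduction `→F` of λ!. -/
def FStep (t u : T) : Prop := ∃ R, FStepR R t u

/-- Surface reduction `→S` of λ!. -/
def SStep (t u : T) : Prop := ∃ R, SStepR R t u

/-- Internal reduction `→I` of λ!. -/
def IStep (t u : T) : Prop := ∃ R, IStepR R t u

/-- Diligent administrative surface reduction `→Sai`: `d!`-surface steps, together with
`dB`- and `s!`-surface steps whose source is a `→S,d!`-normal form. -/
def SaiStep (t u : T) : Prop :=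
  SStepR Rule.dBang t u ∨
    ((SStepR Rule.dB t u ∨ SStepR Rule.sBang t u) ∧ IsNF (SStepR Rule.dBang) t)

/-- Diligent administrative full reduction `→Fai`: `d!`-full steps, together with
`dB`- and `s!`-full steps whose source is a `→F,d!`-normal form. -/
def FaiStep (t u : T) : Prop :=
  FStepR Rule.dBang t u ∨
    ((FStepR Rule.dB t u ∨ FStepR Rule.sBang t u) ∧ IsNF (FStepR Rule.dBang) t)

/-! ### Terms of the CBN / CBV calculi (shared syntax, de Bruijn) -/

/-- Terms of the CBN/CBV calculi: variables, application, abstraction and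
explicit substitution (no `!`, no `der`). -/
inductive LT : Type
  | var : ℕ → LT
  | app : LT → LT → LT
  | lam : LT → LT
  | sub : LT → LT → LT

namespace LT

/-- Lift (shift by one) the free de Bruijn variables `≥ k`. -/
def lift (k : ℕ) : LT → LT
  | var n => if n < k then var n else var (n + 1)
  | app a b => app (lift k a) (lift k b)
  | lam a => lam (lift (k + 1) a)
  | sub a b => sub (lift (k + 1) a) (lift k b)

/-- Lift all free variables by `m`. -/
def liftN (m : ℕ) (t : LT) : LT := (lift 0)^[m] t

/-- Lift all free variables except the first one by `m`. -/
def liftUnder (m : ℕ) (t : LT) : LT := (lift 1)^[m] t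

/-- Capture-avoiding substitution `t{k := u}`. -/
def subst : LT → ℕ → LT → LT
  | var n, k, u => if n < k then var n else if n = k then liftN k u else var (n - 1)
  | app a b, k, u => app (subst a k u) (subst b k u)
  | lam a, k, u => lam (subst a (k + 1) u)
  | sub a b, k, u => sub (subst a (k + 1) u) (subst b k u)

/-- Values: variables and abstractions. -/
def IsValue : LT → Prop
  | var _ => True
  | lam _ => True
  | _ => False

end LT

/-- Plugging a CBN/CBV term into a list context. -/
def fillLN : LT → List LT → LT
  | s, [] => s
  | s, t :: L => fillLN (LT.sub s t) L

/-- The names of the CBN rewrite rules: `dB` and `s`. -/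
inductive NRule : Type
  | dB : NRule
  | s : NRule

/-- Root steps of the CBN rules:
`(dB) L⟨λx.t⟩ u ↦ L⟨t[x←u]⟩` and `(s) t[x←u] ↦ t{x:=u}`. -/
inductive NRoot : NRule → LT → LT → Prop
  | dB (t u : LT) (L : List LT) :
      NRoot NRule.dB (LT.app (fillLN (LT.lam t) L) u)
        (fillLN (LT.sub t (LT.liftN L.length u)) L)
  | s (t u : LT) : NRoot NRule.s (LT.sub t u) (LT.subst t 0 u)

/-- The names of the CBV rewrite rules: `dB` and `sV`. -/
inductive VRule : Type
  | dB : VRule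
  | sV : VRule

/-- Root steps of the CBV rules:
`(dB) L⟨λx.t⟩ u ↦ L⟨t[x←u]⟩` and `(sV) t[x←L⟨v⟩] ↦ L⟨t{x:=v}⟩` for `v` a value. -/
inductive VRoot : VRule → LT → LT → Prop
  | dB (t u : LT) (L : List LT) :
      VRoot VRule.dB (LT.app (fillLN (LT.lam t) L) u)
        (fillLN (LT.sub t (LT.liftN L.length u)) L)
  | sV (t v : LT) (L : List LT) : v.IsValue →
      VRoot VRule.sV (LT.sub t (fillLN v L))
        (fillLN (LT.subst (LT.liftUnder L.length t) 0 v) L)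

/-- (Full) contexts of the CBN/CBV calculi. -/
inductive LCtx : Type
  | hole : LCtx
  | appL : LCtx → LT → LCtx
  | appR : LT → LCtx → LCtx
  | lam : LCtx → LCtx
  | subL : LCtx → LT → LCtx
  | subR : LT → LCtx → LCtx

namespace LCtx

/-- Plugging a term in a CBN/CBV context. -/
def fill : LCtx → LT → LT
  | hole, s => s
  | appL C t, s => LT.app (fill C s) t
  | appR t C, s => LT.app t (fill C s)
  | lam C, s => LT.lam (fill C s)
  | subL C t, s => LT.sub (fill C s) t
  | subR t C, s => LT.sub t (fill C s)

/-- CBN surface contexts: the hole never occurs in the argument of an application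
or of an explicit substitution. -/
def NSurface : LCtx → Prop
  | hole => True
  | appL C _ => NSurface C
  | appR _ _ => False
  | lam C => NSurface C
  | subL C _ => NSurface C
  | subR _ _ => False

/-- CBV surface contexts: the hole never occurs under an abstraction. -/
def VSurface : LCtx → Prop
  | hole => True
  | appL C _ => VSurface C
  | appR _ C => VSurface C
  | lam _ => False
  | subL C _ => VSurface C
  | subR _ C => VSurface C

end LCtx

/-- `NStepAt R C t u`: the CBN step firing rule `R` under context `C`. -/
def NStepAt (R : NRule) (C : LCtx) (t u : LT) : Prop :=
  ∃ a b, NRoot R a b ∧ t = C.fill a ∧ u = C.fill b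

/-- `VStepAt R C t u`: the CBV step firing rule `R` under context `C`. -/
def VStepAt (R : VRule) (C : LCtx) (t u : LT) : Prop :=
  ∃ a b, VRoot R a b ∧ t = C.fill a ∧ u = C.fill b

/-- One CBN step of rule `R` under some full context. -/
def NFStepR (R : NRule) (t u : LT) : Prop := ∃ C : LCtx, NStepAt R C t u

/-- One CBN step of rule `R` under some surface context. -/
def NSStepR (R : NRule) (t u : LT) : Prop := ∃ C : LCtx, C.NSurface ∧ NStepAt R C t u

/-- One CBN step of rule `R` under some internal context. -/
def NIStepR (R : NRule) (t u : LT) : Prop := ∃ C : LCtx, ¬ C.NSurface ∧ NStepAt R C t u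

/-- CBN full reduction `→ⁿF`. -/
def NFStep (t u : LT) : Prop := ∃ R, NFStepR R t u

/-- CBN surface reduction `→ⁿS`. -/
def NSStep (t u : LT) : Prop := ∃ R, NSStepR R t u

/-- CBN internal reduction `→ⁿI`. -/
def NIStep (t u : LT) : Prop := ∃ R, NIStepR R t u

/-- One CBV step of rule `R` under some full context. -/
def VFStepR (R : VRule) (t u : LT) : Prop := ∃ C : LCtx, VStepAt R C t u

/-- One CBV step of rule `R` under some surface context. -/
def VSStepR (R : VRule) (t u : LT) : Prop := ∃ C : LCtx, C.VSurface ∧ VStepAt R C t u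

/-- One CBV step of rule `R` under some internal context. -/
def VIStepR (R : VRule) (t u : LT) : Prop := ∃ C : LCtx, ¬ C.VSurface ∧ VStepAt R C t u

/-- CBV full reduction `→ᵛF`. -/
def VFStep (t u : LT) : Prop := ∃ R, VFStepR R t u

/-- CBV surface reduction `→ᵛS`. -/
def VSStep (t u : LT) : Prop := ∃ R, VSStepR R t u

/-- CBV internal reduction `→ᵛI`. -/
def VIStep (t u : LT) : Prop := ∃ R, VIStepR R t u

/-! ### The CBN embedding into λ! -/

/-- The CBN embedding `(·)ⁿ : xⁿ = x, (λx.t)ⁿ = λx.tⁿ, (t u)ⁿ = tⁿ !(uⁿ),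
(t[x←u])ⁿ = tⁿ[x←!(uⁿ)]`. -/
def embN : LT → T
  | LT.var n => T.var n
  | LT.app t u => T.app (embN t) (T.bang (embN u))
  | LT.lam t => T.lam (embN t)
  | LT.sub t u => T.sub (embN t) (T.bang (embN u))

/-- The CBN embedding extended to contexts, with `⟨·⟩ⁿ = ⟨·⟩`. -/
def embNC : LCtx → Ctx
  | LCtx.hole => Ctx.hole
  | LCtx.appL C t => Ctx.appL (embNC C) (T.bang (embN t))
  | LCtx.appR t C => Ctx.appR (embN t) (Ctx.bang (embNC C))
  | LCtx.lam C => Ctx.lam (embNC C)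
  | LCtx.subL C t => Ctx.subL (embNC C) (T.bang (embN t))
  | LCtx.subR t C => Ctx.subR (embN t) (Ctx.bang (embNC C))

/-- The CBN embedding on rule names: `dBⁿ = dB`, `sⁿ = s!`. -/
def embNRule : NRule → Rule
  | NRule.dB => Rule.dB
  | NRule.s => Rule.sBang

/-! ### The CBV embedding into λ! -/

/-- If `t = L⟨!s⟩` for a list context `L`, return `some L⟨s⟩`, otherwise `none`. -/
def strip? : T → Option T
  | T.bang s => some s
  | T.sub a b => (strip? a).map (fun a' => T.sub a' b)
  | _ => none

/-- The (new) CBV embedding `(·)ᵛ : xᵛ = !x, (λx.t)ᵛ = !λx.!(tᵛ),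
(t u)ᵛ = der(L⟨s⟩ uᵛ)` if `tᵛ = L⟨!s⟩` and `der(der(tᵛ) uᵛ)` otherwise,
`(t[x←u])ᵛ = tᵛ[x←uᵛ]`. -/
def embV : LT → T
  | LT.var n => T.bang (T.var n)
  | LT.lam t => T.bang (T.lam (T.bang (embV t)))
  | LT.app t u =>
      match strip? (embV t) with
      | some s => T.der (T.app s (embV u))
      | none => T.der (T.app (T.der (embV t)) (embV u))
  | LT.sub t u => T.sub (embV t) (embV u)

/-- The CBV embedding on rule names: `dBᵛ = dB`, `sVᵛ = s!`. -/
def embVRule : VRule → Rule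
  | VRule.dB => Rule.dB
  | VRule.sV => Rule.sBang

/-! ### List contexts and stripping of a bang -/

theorem fillL_append (a : T) (L M : List T) : fillL a (L ++ M) = fillL (fillL a L) M := by
  induction L generalizing a with
  | nil => rfl
  | cons _ _ ih => exact ih _

theorem strip?_fillL {a s : T} (h : strip? a = some s) (L : List T) :
    strip? (fillL a L) = some (fillL s L) := by
  induction L generalizing a s with
  | nil => exact h
  | cons b L ih => exact ih (by simp [strip?, h])

theorem exists_fillL_of_strip? {a s : T} (h : strip? a = some s) :
    ∃ r L, a = fillL (T.bang r) L ∧ s = fillL r L := by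
  induction a generalizing s with
  | bang r => exact ⟨r, [], rfl, by simpa [strip?, fillL] using h.symm⟩
  | sub a b iha _ =>
    obtain ⟨s', hs', rfl⟩ := Option.map_eq_some_iff.1 h
    obtain ⟨r, L, rfl, rfl⟩ := iha hs'
    exact ⟨r, L ++ [b], by simp [fillL_append, fillL], by simp [fillL_append, fillL]⟩
  | _ => simp [strip?] at h

theorem strip?_lift (k : ℕ) (a : T) : strip? (T.lift k a) = (strip? a).map (T.lift k) := by
  induction a generalizing k with
  | sub a b iha _ => simp [T.lift, strip?, iha, Function.comp_def]
  | var n => simp only [T.lift]; split <;> rfl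
  | _ => rfl

theorem strip?_liftUnder (n : ℕ) (a : T) :
    strip? (T.liftUnder n a) = (strip? a).map (T.liftUnder n) := by
  induction n generalizing a with
  | zero => exact Option.map_id'.symm
  | succ n ih =>
    refine (ih (T.lift 1 a)).trans ?_
    rw [strip?_lift, Option.map_map]
    rfl

theorem strip?_subst {a s : T} (h : strip? a = some s) (k : ℕ) (u : T) :
    strip? (T.subst a k u) = some (T.subst s k u) := by
  induction a generalizing s k with
  | bang r => simp_all [strip?, T.subst]
  | sub a b iha _ =>
    obtain ⟨s', hs', rfl⟩ := Option.map_eq_some_iff.1 h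
    simp [T.subst, strip?, iha hs']
  | _ => simp [strip?] at h

/-! ### Contextual closure of reduction in λ! -/

/-- Composition of contexts. -/
def Ctx.comp : Ctx → Ctx → Ctx
  | Ctx.hole, D => D
  | Ctx.appL C t, D => Ctx.appL (Ctx.comp C D) t
  | Ctx.appR t C, D => Ctx.appR t (Ctx.comp C D)
  | Ctx.lam C, D => Ctx.lam (Ctx.comp C D)
  | Ctx.bang C, D => Ctx.bang (Ctx.comp C D)
  | Ctx.der C, D => Ctx.der (Ctx.comp C D)
  | Ctx.subL C t, D => Ctx.subL (Ctx.comp C D) t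
  | Ctx.subR t C, D => Ctx.subR t (Ctx.comp C D)

theorem Ctx.fill_comp (C D : Ctx) (a : T) : (C.comp D).fill a = C.fill (D.fill a) := by
  induction C <;> simp_all [Ctx.comp, Ctx.fill]

theorem FStepR.of_root {R : Rule} {a b : T} (h : Root R a b) : FStepR R a b :=
  ⟨Ctx.hole, a, b, h, rfl, rfl⟩

theorem FStepR.fill {R : Rule} {a b : T} (C : Ctx) (h : FStepR R a b) :
    FStepR R (C.fill a) (C.fill b) := by
  obtain ⟨D, a, b, h, rfl, rfl⟩ := h
  exact ⟨C.comp D, a, b, h, (Ctx.fill_comp C D a).symm, (Ctx.fill_comp C D b).symm⟩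

theorem FStepR.strip? {R : Rule} {a b s : T} (h : FStepR R a b)
    (hs : BangPaper.strip? a = some s) : ∃ r, BangPaper.strip? b = some r ∧ FStepR R s r := by
  obtain ⟨C, a, b, h, rfl, rfl⟩ := h
  induction C generalizing s with
  | hole =>
    cases h with
    | sBang t u L =>
      obtain ⟨s', hs', rfl⟩ := Option.map_eq_some_iff.1 hs
      exact ⟨_, strip?_fillL (strip?_subst (by simp [strip?_liftUnder, hs']) 0 u) L,
        .of_root (.sBang s' u L)⟩
    | _ => simp [Ctx.fill, BangPaper.strip?] at hs
  | bang C _ =>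
    cases hs
    exact ⟨_, rfl, C, a, b, h, rfl, rfl⟩
  | subL C t ih =>
    obtain ⟨s', hs', rfl⟩ := Option.map_eq_some_iff.1 hs
    obtain ⟨r, hr, hstep⟩ := ih hs'
    exact ⟨T.sub r t, by simp [Ctx.fill, BangPaper.strip?, hr],
      hstep.fill (Ctx.subL Ctx.hole t)⟩
  | subR t C _ =>
    obtain ⟨s', hs', rfl⟩ := Option.map_eq_some_iff.1 hs
    exact ⟨T.sub s' (C.fill b), by simp [Ctx.fill, BangPaper.strip?, hs'],
      Ctx.subR s' C, a, b, h, rfl, rfl⟩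
  | _ => simp [Ctx.fill, BangPaper.strip?] at hs

/-- One step of rule `R` followed by zero or more `d!`-steps. -/
def StepThenDer (R : Rule) (a b : T) : Prop :=
  ∃ s, FStepR R a s ∧ Relation.ReflTransGen (FStepR Rule.dBang) s b

theorem StepThenDer.fill {R : Rule} {a b : T} (C : Ctx) (h : StepThenDer R a b) :
    StepThenDer R (C.fill a) (C.fill b) := by
  obtain ⟨s, h, hs⟩ := h
  exact ⟨C.fill s, h.fill C, hs.lift C.fill fun _ _ => FStepR.fill C⟩

theorem StepThenDer.tail {R : Rule} {a b c : T} (h : StepThenDer R a b)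
    (hbc : FStepR Rule.dBang b c) : StepThenDer R a c := by
  obtain ⟨s, h, hs⟩ := h
  exact ⟨s, h, hs.tail hbc⟩

theorem StepThenDer.strip? {R : Rule} {a b s : T} (h : StepThenDer R a b)
    (hs : BangPaper.strip? a = some s) :
    ∃ r, BangPaper.strip? b = some r ∧ StepThenDer R s r := by
  obtain ⟨c, hac, hcb⟩ := h
  obtain ⟨c', hc', hstep⟩ := hac.strip? hs
  suffices ∃ r, BangPaper.strip? b = some r ∧
      Relation.ReflTransGen (FStepR Rule.dBang) c' r by
    obtain ⟨r, hr, hcr⟩ := this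
    exact ⟨r, hr, c', hstep, hcr⟩
  induction hcb with
  | refl => exact ⟨c', hc', .refl⟩
  | tail _ hbc ih =>
    obtain ⟨r, hr, hcr⟩ := ih
    obtain ⟨r', hr', hrr⟩ := hbc.strip? hr
    exact ⟨r', hr', hcr.tail hrr⟩

theorem FStepR.der_of_strip? {a s : T} (h : BangPaper.strip? a = some s) :
    FStepR Rule.dBang (T.der a) s := by
  obtain ⟨r, L, rfl, rfl⟩ := exists_fillL_of_strip? h
  exact .of_root (.dBang r L)

/-! ### The CBV embedding commutes with the syntactic operations -/

theorem embV_fillLN (a : LT) (L : List LT) :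
    embV (fillLN a L) = fillL (embV a) (L.map embV) := by
  induction L generalizing a with
  | nil => rfl
  | cons _ _ ih => exact ih _

theorem embV_lift (k : ℕ) (a : LT) : embV (LT.lift k a) = T.lift k (embV a) := by
  induction a generalizing k with
  | var n => simp only [LT.lift, embV, T.lift]; split <;> rfl
  | app a b iha ihb =>
    simp only [LT.lift, embV, iha, ihb, strip?_lift]
    cases strip? (embV a) <;> rfl
  | lam a ih => simp [LT.lift, embV, T.lift, ih]
  | sub a b iha ihb => simp [LT.lift, embV, T.lift, iha, ihb]

theorem embV_liftN (n : ℕ) (a : LT) : embV (LT.liftN n a) = T.liftN n (embV a) :=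
  Function.Semiconj.iterate_right (embV_lift 0) n a

theorem embV_liftUnder (n : ℕ) (a : LT) : embV (LT.liftUnder n a) = T.liftUnder n (embV a) :=
  Function.Semiconj.iterate_right (embV_lift 1) n a

theorem liftN_bang (n : ℕ) (a : T) : T.liftN n (T.bang a) = T.bang (T.liftN n a) :=
  (Function.Semiconj.iterate_right (f := T.bang) (ga := T.lift 0) (gb := T.lift 0)
    (fun _ => rfl) n a).symm

theorem strip?_subst_embV (a : LT) (k : ℕ) (w : T) :
    strip? (T.subst (embV a) k w) = (strip? (embV a)).map fun s => T.subst s k w := by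
  induction a generalizing k with
  | app a b _ _ => simp only [embV]; split <;> rfl
  | sub a b iha _ => simp [embV, T.subst, strip?, iha, Function.comp_def]
  | _ => rfl

theorem embV_subst {v : LT} {w : T} (h : embV v = T.bang w) (a : LT) (k : ℕ) :
    embV (LT.subst a k v) = T.subst (embV a) k w := by
  induction a generalizing k with
  | var n =>
    simp only [LT.subst, embV, T.subst]
    split_ifs <;> simp [embV, embV_liftN, h, liftN_bang]
  | app a b iha ihb =>
    simp only [LT.subst, embV, iha, ihb, strip?_subst_embV]
    cases strip? (embV a) <;> rfl
  | lam a ih => simp [LT.subst, embV, T.subst, ih]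
  | sub a b iha ihb => simp [LT.subst, embV, T.subst, iha, ihb]

theorem LT.IsValue.exists_embV_eq_bang {v : LT} (h : v.IsValue) : ∃ w, embV v = T.bang w := by
  cases v with
  | var n => exact ⟨_, rfl⟩
  | lam a => exact ⟨_, rfl⟩
  | _ => exact h.elim

theorem embV_app_of_strip? {a : LT} {s : T} (h : strip? (embV a) = some s) (b : LT) :
    embV (LT.app a b) = T.der (T.app s (embV b)) := by
  simp [embV, h]

theorem embV_app_of_strip?_eq_none {a : LT} (h : strip? (embV a) = none) (b : LT) :
    embV (LT.app a b) = T.der (T.app (T.der (embV a)) (embV b)) := by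
  simp [embV, h]

/-! ### Simulation -/

theorem VRoot.stepThenDer {R : VRule} {a b : LT} (h : VRoot R a b) :
    StepThenDer (embVRule R) (embV a) (embV b) := by
  cases h with
  | dB t u L =>
    have hs : strip? (embV (fillLN (LT.lam t) L)) =
        some (fillL (T.lam (T.bang (embV t))) (L.map embV)) := by
      rw [embV_fillLN]
      exact strip?_fillL rfl _
    rw [embV_app_of_strip? hs, embV_fillLN]
    refine ⟨_, (FStepR.of_root (.dB _ _ _)).fill (Ctx.der Ctx.hole), .single ?_⟩
    simpa [embV, embV_liftN, fillL, Ctx.fill] using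
      FStepR.of_root (.dBang (embV t) (T.liftN L.length (embV u) :: L.map embV))
  | sV t v L hv =>
    obtain ⟨w, hw⟩ := hv.exists_embV_eq_bang
    refine ⟨_, ?_, .refl⟩
    simpa [embV, embVRule, embV_fillLN, embV_subst hw, embV_liftUnder, hw] using
      FStepR.of_root (.sBang (embV t) w (L.map embV))

theorem StepThenDer.embV_appL {R : Rule} {a b : LT} (h : StepThenDer R (embV a) (embV b))
    (t : LT) : StepThenDer R (embV (LT.app a t)) (embV (LT.app b t)) := by
  cases ha : BangPaper.strip? (embV a) with
  | some s =>
    obtain ⟨r, hr, hsr⟩ := h.strip? ha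
    rw [embV_app_of_strip? ha, embV_app_of_strip? hr]
    exact hsr.fill (Ctx.der (Ctx.appL Ctx.hole (embV t)))
  | none =>
    rw [embV_app_of_strip?_eq_none ha]
    have h' := h.fill (Ctx.der (Ctx.appL (Ctx.der Ctx.hole) (embV t)))
    cases hb : BangPaper.strip? (embV b) with
    | some s =>
      rw [embV_app_of_strip? hb]
      exact h'.tail ((FStepR.der_of_strip? hb).fill (Ctx.der (Ctx.appL Ctx.hole (embV t))))
    | none =>
      rw [embV_app_of_strip?_eq_none hb]
      exact h'

theorem StepThenDer.embV_appR {R : Rule} {a b : LT} (h : StepThenDer R (embV a) (embV b))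
    (t : LT) : StepThenDer R (embV (LT.app t a)) (embV (LT.app t b)) := by
  cases ht : BangPaper.strip? (embV t) with
  | some s =>
    rw [embV_app_of_strip? ht, embV_app_of_strip? ht]
    exact h.fill (Ctx.der (Ctx.appR s Ctx.hole))
  | none =>
    rw [embV_app_of_strip?_eq_none ht, embV_app_of_strip?_eq_none ht]
    exact h.fill (Ctx.der (Ctx.appR (T.der (embV t)) Ctx.hole))

theorem StepThenDer.embV_fill {R : Rule} {a b : LT} (h : StepThenDer R (embV a) (embV b))
    (C : LCtx) : StepThenDer R (embV (C.fill a)) (embV (C.fill b)) := by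
  induction C with
  | hole => exact h
  | appL C t ih => exact ih.embV_appL t
  | appR t C ih => exact ih.embV_appR t
  | lam C ih => exact ih.fill (Ctx.bang (Ctx.lam (Ctx.bang Ctx.hole)))
  | subL C t ih => exact ih.fill (Ctx.subL Ctx.hole (embV t))
  | subR t C ih => exact ih.fill (Ctx.subR (embV t) Ctx.hole)

/-- **CBV one-step simulation.**  If `t →ᵛF u` by firing rule `R ∈ {dB, sV}` (under
some CBV full context), then in λ! the term `tᵛ` reaches `uᵛ` by one `→F`-step of
rule `Rᵛ` followed by zero or more `→F,d!`-steps. -/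
theorem cbv_one_step_simulation (t u : LT) (R : VRule)
    (h : VFStepR R t u) :
    ∃ s, FStepR (embVRule R) (embV t) s ∧
      Relation.ReflTransGen (FStepR Rule.dBang) s (embV u) := by
  obtain ⟨C, a, b, h, rfl, rfl⟩ := h
  exact h.stepThenDer.embV_fill C

end BangPaper
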